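/- Let p : [0,∞) → ℝ be nondecreasing, Y a nonnegative integrable random variable with E[∫_δ^{δ+z+Y}|p(t)|dt] < ∞ and E[|p(δ+z+Y)|] < ∞ for all z ≥ 0, and fix δ ≥ 0. Define g̃ : [0,∞) → ℝ by g̃(z) = E[ ∫_δ^{δ+z+Y} p(t) dt ]. Then: (i) g̃ is convex on [0,∞); (ii) for every z ≥ 0 the right derivative of g̃ at z exists and equals lim_{z'→z⁺} E[ p(δ + z' + Y) ]; (iii) for every z > 0 the left derivative of g̃ at z exists and equals lim_{z'→z⁻} E[ p(δ + z' + Y) ]. (The one-sided derivative formulas (first displayed derivatives in Appendix E / equations (27)-(28) style) used throughout the paper's proofs.) -/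

import Mathlib

open MeasureTheory

section SandwichedIncrements

variable {g G : ℝ → ℝ}

/-- A function whose increments over `[a, b]` lie between `G a * (b - a)` and `G b * (b - a)`
is convex. -/
theorem convexOn_Ici_of_sandwiched_increments
    (hlow : ∀ a b, 0 ≤ a → a ≤ b → G a * (b - a) ≤ g b - g a)
    (hupp : ∀ a b, 0 ≤ a → a ≤ b → g b - g a ≤ G b * (b - a)) :
    ConvexOn ℝ (Set.Ici 0) g := by
  refine convexOn_of_slope_mono_adjacent (convex_Ici 0) ?_
  intro x y z hx _ hxy hyz
  have hx' : 0 ≤ x := hx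
  calc (g y - g x) / (y - x) ≤ G y := by
        rw [div_le_iff₀ (by linarith)]
        exact hupp x y hx' hxy.le
    _ ≤ (g z - g y) / (z - y) := by
        rw [le_div_iff₀ (by linarith)]
        exact hlow y z (by linarith) hyz.le

/-- If the increments of `g` are sandwiched by the nondecreasing function `G`, then the right
derivative of `g` is the right limit of `G`. -/
theorem exists_tendsto_hasDerivWithinAt_Ici (hG : MonotoneOn G (Set.Ici 0))
    (hlow : ∀ a b, 0 ≤ a → a ≤ b → G a * (b - a) ≤ g b - g a)
    (hupp : ∀ a b, 0 ≤ a → a ≤ b → g b - g a ≤ G b * (b - a)) {z : ℝ} (hz : 0 ≤ z) :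
    ∃ L : ℝ, Filter.Tendsto G (nhdsWithin z (Set.Ioi z)) (nhds L) ∧
      HasDerivWithinAt g L (Set.Ici z) z := by
  have hbdd : BddBelow (G '' Set.Ioi z) := by
    refine ⟨G z, ?_⟩
    rintro _ ⟨w, hw, rfl⟩
    have hw' : z < w := hw
    exact hG hz (hz.trans hw'.le) hw'.le
  have hmono : MonotoneOn G (Set.Ioi z) :=
    hG.mono fun w hw => hz.trans (Set.mem_Ioi.mp hw).le
  have hL := hmono.tendsto_nhdsGT hbdd
  refine ⟨sInf (G '' Set.Ioi z), hL, ?_⟩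
  set L := sInf (G '' Set.Ioi z)
  rw [← hasDerivWithinAt_Ioi_iff_Ici, hasDerivWithinAt_iff_tendsto_slope' (by simp)]
  refine tendsto_of_tendsto_of_tendsto_of_le_of_le' tendsto_const_nhds hL ?_ ?_
  · filter_upwards [self_mem_nhdsWithin] with y hy
    have hy' : z < y := hy
    rw [slope_def_field, le_div_iff₀ (by linarith)]
    have hlim : Filter.Tendsto (fun w => L * (y - w) + G z * (w - z))
        (nhdsWithin z (Set.Ioi z)) (nhds (L * (y - z) + G z * (z - z))) :=
      Filter.Tendsto.mono_left (Continuous.tendsto (by fun_prop) z) nhdsWithin_le_nhds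
    rw [sub_self, mul_zero, add_zero] at hlim
    refine le_of_tendsto hlim ?_
    filter_upwards [Ioo_mem_nhdsGT hy'] with w hw
    have hLw : L ≤ G w := csInf_le hbdd ⟨w, hw.1, rfl⟩
    have hzw := hlow z w hz hw.1.le
    have hwy := hlow w y (hz.trans hw.1.le) hw.2.le
    have := mul_le_mul_of_nonneg_right hLw (sub_nonneg.mpr hw.2.le)
    linarith
  · filter_upwards [self_mem_nhdsWithin] with y hy
    have hy' : z < y := hy
    rw [slope_def_field, div_le_iff₀ (by linarith)]
    exact hupp z y hz hy'.le

/-- If the increments of `g` are sandwiched by the nondecreasing function `G`, then the left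
derivative of `g` is the left limit of `G`. -/
theorem exists_tendsto_hasDerivWithinAt_Iic (hG : MonotoneOn G (Set.Ici 0))
    (hlow : ∀ a b, 0 ≤ a → a ≤ b → G a * (b - a) ≤ g b - g a)
    (hupp : ∀ a b, 0 ≤ a → a ≤ b → g b - g a ≤ G b * (b - a)) {z : ℝ} (hz : 0 < z) :
    ∃ L : ℝ, Filter.Tendsto G (nhdsWithin z (Set.Iio z)) (nhds L) ∧
      HasDerivWithinAt g L (Set.Iic z) z := by
  have hbdd : BddAbove (G '' Set.Ioo 0 z) := by
    refine ⟨G z, ?_⟩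
    rintro _ ⟨w, hw, rfl⟩
    exact hG hw.1.le hz.le hw.2.le
  have hmono : MonotoneOn G (Set.Ioo 0 z) := hG.mono fun w hw => hw.1.le
  have hL : Filter.Tendsto G (nhdsWithin z (Set.Iio z)) (nhds (sSup (G '' Set.Ioo 0 z))) :=
    hmono.tendsto_nhdsWithin_Ioo_left (Set.nonempty_Ioo.mpr hz) hbdd
  refine ⟨sSup (G '' Set.Ioo 0 z), hL, ?_⟩
  set L := sSup (G '' Set.Ioo 0 z)
  rw [← hasDerivWithinAt_Iio_iff_Iic, hasDerivWithinAt_iff_tendsto_slope' (by simp)]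
  refine tendsto_of_tendsto_of_tendsto_of_le_of_le' hL tendsto_const_nhds ?_ ?_
  · filter_upwards [Ioo_mem_nhdsLT hz] with y hy
    rw [slope_comm, slope_def_field, le_div_iff₀ (by linarith [hy.2])]
    exact hlow y z hy.1.le hy.2.le
  · filter_upwards [Ioo_mem_nhdsLT hz] with y hy
    rw [slope_comm, slope_def_field, div_le_iff₀ (by linarith [hy.2])]
    have hlim : Filter.Tendsto (fun w => L * (w - y) + G z * (z - w))
        (nhdsWithin z (Set.Iio z)) (nhds (L * (z - y) + G z * (z - z))) :=
      Filter.Tendsto.mono_left (Continuous.tendsto (by fun_prop) z) nhdsWithin_le_nhds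
    rw [sub_self, mul_zero, add_zero] at hlim
    refine ge_of_tendsto hlim ?_
    filter_upwards [Ioo_mem_nhdsLT hy.2] with w hw
    have hw0 : 0 < w := hy.1.trans hw.1
    have hLw : G w ≤ L := le_csSup hbdd ⟨w, ⟨hw0, hw.2⟩, rfl⟩
    have hyw := hupp y w hy.1.le hw.1.le
    have hwz := hupp w z hw0.le hw.2.le
    have := mul_le_mul_of_nonneg_right hLw (sub_nonneg.mpr hw.1.le)
    linarith

end SandwichedIncrements

section MonotonePenalty

variable {p : ℝ → ℝ}

theorem MonotoneOn.intervalIntegrable_of_nonneg (hp : MonotoneOn p (Set.Ici 0)) {a b : ℝ}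
    (ha : 0 ≤ a) (hb : 0 ≤ b) : IntervalIntegrable p volume a b :=
  MonotoneOn.intervalIntegrable
    (hp.mono fun _ hx => (le_min ha hb).trans hx.1)

theorem MonotoneOn.mul_sub_le_intervalIntegral (hp : MonotoneOn p (Set.Ici 0)) {a b : ℝ}
    (ha : 0 ≤ a) (hab : a ≤ b) : p a * (b - a) ≤ ∫ t in a..b, p t := by
  have h := intervalIntegral.integral_mono_on hab intervalIntegrable_const
    (hp.intervalIntegrable_of_nonneg ha (ha.trans hab))
    (fun t ht => hp ha (ha.trans ht.1) ht.1)
  rwa [intervalIntegral.integral_const, smul_eq_mul, mul_comm] at h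

theorem MonotoneOn.intervalIntegral_le_mul_sub (hp : MonotoneOn p (Set.Ici 0)) {a b : ℝ}
    (ha : 0 ≤ a) (hab : a ≤ b) : ∫ t in a..b, p t ≤ p b * (b - a) := by
  have h := intervalIntegral.integral_mono_on hab
    (hp.intervalIntegrable_of_nonneg ha (ha.trans hab)) intervalIntegrable_const
    (fun t ht => hp (ha.trans ht.1) (ha.trans hab) ht.2)
  rwa [intervalIntegral.integral_const, smul_eq_mul, mul_comm] at h

/-- The primitive of a function nondecreasing on `[0, ∞)`, evaluated at a nonnegative random
variable, is measurable. -/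
theorem MonotoneOn.measurable_intervalIntegral {Ω : Type*} [MeasurableSpace Ω]
    (hp : MonotoneOn p (Set.Ici 0)) {a : ℝ} (ha : 0 ≤ a) {X : Ω → ℝ} (hX : Measurable X)
    (hX0 : ∀ ω, 0 ≤ X ω) : Measurable fun ω => ∫ t in a..X ω, p t := by
  have hq : Monotone fun t => p (max t 0) := fun s t hst =>
    hp (le_max_right s 0) (le_max_right t 0) (max_le_max_right 0 hst)
  have hcont : Continuous fun x => ∫ t in a..x, p (max t 0) :=
    intervalIntegral.continuous_primitive (fun _ _ => hq.intervalIntegrable) a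
  convert hcont.measurable.comp hX using 2 with ω
  refine intervalIntegral.integral_congr fun t ht => ?_
  have ht0 : 0 ≤ t := (le_min ha (hX0 ω)).trans ht.1
  simp only [max_eq_left ht0]

end MonotonePenalty

/-- One-sided derivative formulas (paper's Appendix E, equations (27)-(28) style):
`g̃(z) = E[∫_δ^{δ+z+Y} p(t) dt]` is convex on `[0,∞)`; its right derivative at each `z ≥ 0`
exists and equals `lim_{z'→z⁺} E[p(δ+z'+Y)]`, and its left derivative at each `z > 0`
exists and equals `lim_{z'→z⁻} E[p(δ+z'+Y)]`. -/
theorem stmt14 {Ω : Type*} [MeasurableSpace Ω] (μ : Measure Ω) [IsProbabilityMeasure μ]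
    (p : ℝ → ℝ) (hp : MonotoneOn p (Set.Ici 0)) (hpm : Measurable p)
    (Y : Ω → ℝ) (hY : Measurable Y) (hYpos : ∀ ω, 0 ≤ Y ω) (hYint : Integrable Y μ)
    (δ : ℝ) (hδ : 0 ≤ δ)
    (hint1 : ∀ z : ℝ, 0 ≤ z →
      Integrable (fun ω => ∫ t in δ..(δ + z + Y ω), |p t|) μ)
    (hint2 : ∀ z : ℝ, 0 ≤ z → Integrable (fun ω => p (δ + z + Y ω)) μ)
    (g : ℝ → ℝ) (hg : ∀ z, g z = ∫ ω, (∫ t in δ..(δ + z + Y ω), p t) ∂μ) :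
    ConvexOn ℝ (Set.Ici 0) g ∧
      (∀ z : ℝ, 0 ≤ z → ∃ L : ℝ,
        Filter.Tendsto (fun z' => ∫ ω, p (δ + z' + Y ω) ∂μ)
          (nhdsWithin z (Set.Ioi z)) (nhds L) ∧
        HasDerivWithinAt g L (Set.Ici z) z) ∧
      (∀ z : ℝ, 0 < z → ∃ L : ℝ,
        Filter.Tendsto (fun z' => ∫ ω, p (δ + z' + Y ω) ∂μ)
          (nhdsWithin z (Set.Iio z)) (nhds L) ∧
        HasDerivWithinAt g L (Set.Iic z) z) := by
  have hX0 : ∀ z, 0 ≤ z → ∀ ω, 0 ≤ δ + z + Y ω := fun z hz ω =>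
    add_nonneg (add_nonneg hδ hz) (hYpos ω)
  have hint : ∀ z, 0 ≤ z → Integrable (fun ω => ∫ t in δ..(δ + z + Y ω), p t) μ := by
    intro z hz
    refine (hint1 z hz).mono' (hp.measurable_intervalIntegral hδ
      (hY.const_add (δ + z)) (hX0 z hz)).aestronglyMeasurable (ae_of_all μ fun ω => ?_)
    exact intervalIntegral.norm_integral_le_integral_norm (by linarith [hYpos ω])
  have hincr : ∀ a b, 0 ≤ a → 0 ≤ b → g b - g a =
      ∫ ω, (∫ t in (δ + a + Y ω)..(δ + b + Y ω), p t) ∂μ := by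
    intro a b ha hb
    rw [hg, hg, ← integral_sub (hint b hb) (hint a ha)]
    refine integral_congr_ae (ae_of_all μ fun ω => ?_)
    exact intervalIntegral.integral_interval_sub_left
      (hp.intervalIntegrable_of_nonneg hδ (hX0 b hb ω))
      (hp.intervalIntegrable_of_nonneg hδ (hX0 a ha ω))
  have hincr_int : ∀ a b, 0 ≤ a → 0 ≤ b →
      Integrable (fun ω => ∫ t in (δ + a + Y ω)..(δ + b + Y ω), p t) μ := by
    intro a b ha hb
    refine ((hint b hb).sub (hint a ha)).congr (ae_of_all μ fun ω => ?_)
    exact intervalIntegral.integral_interval_sub_left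
      (hp.intervalIntegrable_of_nonneg hδ (hX0 b hb ω))
      (hp.intervalIntegrable_of_nonneg hδ (hX0 a ha ω))
  have hG : MonotoneOn (fun z => ∫ ω, p (δ + z + Y ω) ∂μ) (Set.Ici 0) := by
    intro a ha b hb hab
    exact integral_mono (hint2 a ha) (hint2 b hb) fun ω =>
      hp (hX0 a ha ω) (hX0 b hb ω) (by linarith)
  have hlow : ∀ a b, 0 ≤ a → a ≤ b →
      (∫ ω, p (δ + a + Y ω) ∂μ) * (b - a) ≤ g b - g a := by
    intro a b ha hab
    rw [hincr a b ha (ha.trans hab), ← integral_mul_const]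
    refine integral_mono ((hint2 a ha).mul_const _) (hincr_int a b ha (ha.trans hab)) fun ω => ?_
    have h := hp.mul_sub_le_intervalIntegral (hX0 a ha ω)
      (show δ + a + Y ω ≤ δ + b + Y ω by linarith)
    rwa [show δ + b + Y ω - (δ + a + Y ω) = b - a by ring] at h
  have hupp : ∀ a b, 0 ≤ a → a ≤ b →
      g b - g a ≤ (∫ ω, p (δ + b + Y ω) ∂μ) * (b - a) := by
    intro a b ha hab
    have hb := ha.trans hab
    rw [hincr a b ha hb, ← integral_mul_const]
    refine integral_mono (hincr_int a b ha hb) ((hint2 b hb).mul_const _) fun ω => ?_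
    have h := hp.intervalIntegral_le_mul_sub (hX0 a ha ω)
      (show δ + a + Y ω ≤ δ + b + Y ω by linarith)
    rwa [show δ + b + Y ω - (δ + a + Y ω) = b - a by ring] at h
  exact ⟨convexOn_Ici_of_sandwiched_increments hlow hupp,
    fun z hz => exists_tendsto_hasDerivWithinAt_Ici hG hlow hupp hz,
    fun z hz => exists_tendsto_hasDerivWithinAt_Iic hG hlow hupp hz⟩
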